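/- For the context-free language L = {a^n b^n : n ≥ 1}, the language M_L = ⋃_{n ≥ 1} (a^n b^n ⧢ b^n a^n) satisfies M_L ∩ a^* b^* a^* = {a^n b^(2n) a^n : n ≥ 1}, and hence M_L is not context-free. -/

import Mathlib

/-- `Shuffle u v w` means `w` is an interleaving (shuffle) of `u` and `v`. -/
inductive Shuffle {α : Type*} : List α → List α → List α → Prop
  | nil : Shuffle [] [] []
  | left {a : α} {u v w : List α} : Shuffle u v w → Shuffle (a :: u) v (a :: w)
  | right {a : α} {u v w : List α} : Shuffle u v w → Shuffle u (a :: v) (a :: w)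

/-- The two-letter alphabet {a, b}. -/
inductive AB : Type
  | a : AB
  | b : AB

/-- `M_L = ⋃_{n ≥ 1} (aⁿbⁿ ⧢ bⁿaⁿ)` for `L = {aⁿbⁿ : n ≥ 1}`. -/
def ML : Set (List AB) :=
  {z | ∃ n : ℕ, 1 ≤ n ∧
    Shuffle (List.replicate n AB.a ++ List.replicate n AB.b)
      (List.replicate n AB.b ++ List.replicate n AB.a) z}

namespace Shuffle

variable {α : Type*} {u v w : List α}

theorem symm (h : Shuffle u v w) : Shuffle v u w := by
  induction h with
  | nil => exact .nil
  | left _ ih => exact ih.right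
  | right _ ih => exact ih.left

theorem append_left (l : List α) (h : Shuffle u v w) : Shuffle (l ++ u) v (l ++ w) := by
  induction l with
  | nil => exact h
  | cons _ _ ih => exact ih.left

theorem append_right (l : List α) (h : Shuffle u v w) : Shuffle u (l ++ v) (l ++ w) :=
  (h.symm.append_left l).symm

theorem concat_left (a : α) (h : Shuffle u v w) : Shuffle (u ++ [a]) v (w ++ [a]) := by
  induction h with
  | nil => exact .left .nil
  | left _ ih => exact ih.left
  | right _ ih => exact ih.right

theorem concat_right (a : α) (h : Shuffle u v w) : Shuffle u (v ++ [a]) (w ++ [a]) :=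
  (h.symm.concat_left a).symm

theorem reverse (h : Shuffle u v w) : Shuffle u.reverse v.reverse w.reverse := by
  induction h with
  | nil => exact .nil
  | left _ ih => simpa using ih.concat_left _
  | right _ ih => simpa using ih.concat_right _

theorem perm (h : Shuffle u v w) : w.Perm (u ++ v) := by
  induction h with
  | nil => exact .nil
  | left _ ih => exact ih.cons _
  | right _ ih => exact (ih.cons _).trans List.perm_middle.symm

/-- A shuffle of `aⁿbᵐ` with a word that starts with `b` has at most `n` leading `a`s. -/
theorem le_of_replicate_append {a b : α} (hab : a ≠ b) {n m i : ℕ}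
    (h : Shuffle (List.replicate n a ++ List.replicate m b) (b :: v)
      (List.replicate i a ++ w)) : i ≤ n := by
  induction i generalizing n with
  | zero => exact n.zero_le
  | succ i ih =>
    cases n with
    | zero =>
      cases m with
      | zero =>
        simp only [List.replicate_succ, List.replicate_zero, List.nil_append, List.cons_append] at h
        cases h
        exact absurd rfl hab
      | succ m =>
        simp only [List.replicate_succ, List.replicate_zero, List.nil_append, List.cons_append] at h
        cases h <;> exact absurd rfl hab
    | succ n =>
      simp only [List.replicate_succ, List.cons_append] at h
      cases h with
      | left h => exact Nat.succ_le_succ (ih h)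
      | right h => exact absurd rfl hab

end Shuffle

theorem ML_inter_eq :
    ML ∩
        {z | ∃ i j k : ℕ, z = List.replicate i AB.a ++ List.replicate j AB.b ++
            List.replicate k AB.a} =
      {z | ∃ n : ℕ, 1 ≤ n ∧
          z = List.replicate n AB.a ++ List.replicate (2 * n) AB.b ++ List.replicate n AB.a} := by
  have hab : AB.a ≠ AB.b := by simp
  ext z
  constructor
  · rintro ⟨⟨n, hn, h⟩, i, j, k, rfl⟩
    classical
    have hcount := fun c => h.perm.count_eq c
    have hb := hcount AB.b
    have ha := hcount AB.a
    simp only [List.count_append, List.count_replicate] at ha hb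
    simp at ha hb
    obtain ⟨m, rfl⟩ : ∃ m, n = m + 1 := ⟨n - 1, by omega⟩
    have hi : i ≤ m + 1 := by
      rw [List.append_assoc, List.replicate_succ (a := AB.b), List.cons_append,
        ← List.replicate_succ] at h
      exact h.le_of_replicate_append hab
    have hk : k ≤ m + 1 := by
      have h' := h.reverse.symm
      simp only [List.reverse_append, List.reverse_replicate] at h'
      rw [List.replicate_succ (a := AB.b), List.cons_append, ← List.replicate_succ] at h'
      exact h'.le_of_replicate_append hab
    refine ⟨m + 1, hn, ?_⟩
    rw [show i = m + 1 by omega, show k = m + 1 by omega, show j = 2 * (m + 1) by omega]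
  · rintro ⟨n, hn, rfl⟩
    refine ⟨⟨n, hn, ?_⟩, n, 2 * n, n, rfl⟩
    have h := (((Shuffle.nil.append_right (List.replicate n AB.a)).append_right
      (List.replicate n AB.b)).append_left (List.replicate n AB.b)).append_left
      (List.replicate n AB.a)
    rw [two_mul, List.replicate_add]
    simpa only [List.append_nil, List.append_assoc] using h

namespace ContextFreeGrammar

variable {T N : Type*}

/-- `Yields R n β w`: the sentential form `β` derives the word `w` by a parse forest that uses
only the rules in `R` and has exactly `n` internal nodes. -/
inductive Yields (R : Finset (ContextFreeRule T N)) : ℕ → List (Symbol T N) → List T → Prop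
  | nil : Yields R 0 [] []
  | terminal {n : ℕ} {β : List (Symbol T N)} {w : List T} (t : T) :
      Yields R n β w → Yields R n (.terminal t :: β) (t :: w)
  | nonterminal {n m : ℕ} {β : List (Symbol T N)} {u w : List T} {r : ContextFreeRule T N} :
      r ∈ R → Yields R n r.output u → Yields R m β w →
      Yields R (n + m + 1) (.nonterminal r.input :: β) (u ++ w)

namespace Yields

variable {R R' : Finset (ContextFreeRule T N)} {n m : ℕ} {β γ : List (Symbol T N)} {w x : List T}

theorem mono (hR : R ⊆ R') (h : Yields R n β w) : Yields R' n β w := by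
  induction h with
  | nil => exact .nil
  | terminal t _ ih => exact ih.terminal t
  | nonterminal hr _ _ ih₁ ih₂ => exact .nonterminal (hR hr) ih₁ ih₂

theorem append (h : Yields R n β w) (h' : Yields R m γ x) :
    Yields R (n + m) (β ++ γ) (w ++ x) := by
  induction h with
  | nil => simpa using h'
  | terminal t _ ih => exact ih.terminal t
  | @nonterminal n₁ n₂ _ _ _ _ hr h₁ _ _ ih =>
    rw [List.append_assoc, show n₁ + n₂ + 1 + m = n₁ + (n₂ + m) + 1 by omega]
    exact .nonterminal hr h₁ ih

theorem exists_of_append (h : Yields R n (β ++ γ) w) :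
    ∃ n₁ n₂ w₁ w₂, w = w₁ ++ w₂ ∧ Yields R n₁ β w₁ ∧ Yields R n₂ γ w₂ := by
  induction β generalizing n w with
  | nil => exact ⟨0, n, [], w, rfl, .nil, h⟩
  | cons s β ih =>
    cases h with
    | terminal t h =>
      obtain ⟨n₁, n₂, w₁, w₂, rfl, h₁, h₂⟩ := ih h
      exact ⟨n₁, n₂, t :: w₁, w₂, rfl, h₁.terminal t, h₂⟩
    | @nonterminal k _ _ u _ r hr h' h =>
      obtain ⟨n₁, n₂, w₁, w₂, rfl, h₁, h₂⟩ := ih h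
      exact ⟨k + n₁ + 1, n₂, u ++ w₁, w₂, by simp, .nonterminal hr h' h₁, h₂⟩

theorem map_terminal (w : List T) : Yields R 0 (w.map .terminal) w := by
  induction w with
  | nil => exact .nil
  | cons t _ ih => exact ih.terminal t

theorem of_rule {r : ContextFreeRule T N} (hr : r ∈ R) (h : Yields R n r.output w) :
    Yields R (n + 1) [.nonterminal r.input] w := by
  simpa using Yields.nonterminal hr h .nil

/-- Either the nonterminal `A` is not expanded in a parse forest, or the forest contains a parse
tree with root `A`. -/
theorem avoid_or_exists_subtree [DecidableEq N] (A : N) (h : Yields R n β w) :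
    Yields (R.filter fun r => r.input ≠ A) n β w ∨
      ∃ u x z k, w = u ++ x ++ z ∧ k ≤ n ∧ Yields R k [.nonterminal A] x := by
  induction h with
  | nil => exact .inl .nil
  | terminal t _ ih =>
    obtain h | ⟨u, x, z, k, rfl, hk, h⟩ := ih
    · exact .inl (h.terminal t)
    · exact .inr ⟨t :: u, x, z, k, rfl, hk, h⟩
  | @nonterminal n m _ u' w' r hr h _ ih₁ ih₂ =>
    by_cases hA : r.input = A
    · exact .inr ⟨[], u', w', n + 1, rfl, by omega, hA ▸ of_rule hr h⟩
    · obtain h₁ | ⟨u, x, z, k, rfl, hk, h⟩ := ih₁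
      · obtain h₂ | ⟨u, x, z, k, rfl, hk, h⟩ := ih₂
        · exact .inl (.nonterminal (Finset.mem_filter.2 ⟨hr, hA⟩) h₁ h₂)
        · exact .inr ⟨u' ++ u, x, z, k, by simp, by omega, h⟩
      · exact .inr ⟨u, x, z ++ w', k, by simp, by omega, h⟩

end Yields

theorem Derives.exists_yields {g : ContextFreeGrammar T} {β : List (Symbol T g.NT)} {w : List T}
    (h : g.Derives β (w.map .terminal)) : ∃ n, Yields g.rules n β w := by
  induction h using Relation.ReflTransGen.head_induction_on with
  | refl => exact ⟨0, .map_terminal w⟩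
  | head h _ ih =>
    obtain ⟨r, hr, h⟩ := h
    obtain ⟨p, q, rfl, rfl⟩ := h.exists_parts
    obtain ⟨_, hn⟩ := ih
    obtain ⟨_, _, _, _, rfl, h', h₃⟩ := hn.exists_of_append
    obtain ⟨_, _, _, _, rfl, h₁, h₂⟩ := h'.exists_of_append
    exact ⟨_, (h₁.append (h₂.of_rule hr)).append h₃⟩

theorem Yields.derives {g : ContextFreeGrammar T} {n : ℕ} {β : List (Symbol T g.NT)} {w : List T}
    (h : Yields g.rules n β w) : g.Derives β (w.map .terminal) := by
  induction h with
  | nil => exact .refl _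
  | terminal t _ ih => exact ih.append_left [.terminal t]
  | @nonterminal _ _ β u _ r hr _ _ ih₁ ih₂ =>
    have h : g.Produces ([.nonterminal r.input] ++ β) (r.output ++ β) :=
      Produces.append_right ⟨r, hr, .input_output⟩ β
    rw [List.map_append]
    exact h.trans_derives ((ih₁.append_right β).trans (ih₂.append_left _))

/-- `PumpsDown R c β w`: two factors of `w`, not both empty and lying in a window of length at most
`c`, can be deleted such that the result is still derived from `β` using the rules in `R`. -/
def PumpsDown (R : Finset (ContextFreeRule T N)) (c : ℕ) (β : List (Symbol T N))
    (w : List T) : Prop :=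
  ∃ u v x y z n, w = u ++ (v ++ x ++ y) ++ z ∧ (v ++ x ++ y).length ≤ c ∧ 1 ≤ (v ++ y).length ∧
    Yields R n β (u ++ x ++ z)

namespace PumpsDown

variable {R R' : Finset (ContextFreeRule T N)} {c c' : ℕ} {β γ : List (Symbol T N)} {w : List T}

theorem mono (hR : R ⊆ R') (hc : c ≤ c') : PumpsDown R c β w → PumpsDown R' c' β w :=
  fun ⟨u, v, x, y, z, n, hw, hl, hvy, h⟩ => ⟨u, v, x, y, z, n, hw, hl.trans hc, hvy, h.mono hR⟩

theorem of_rule {r : ContextFreeRule T N} (hr : r ∈ R) :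
    PumpsDown R c r.output w → PumpsDown R c [.nonterminal r.input] w :=
  fun ⟨u, v, x, y, z, n, hw, hl, hvy, h⟩ => ⟨u, v, x, y, z, n + 1, hw, hl, hvy, h.of_rule hr⟩

theorem append_right {n : ℕ} {x : List T} (h' : Yields R n γ x) :
    PumpsDown R c β w → PumpsDown R c (β ++ γ) (w ++ x) := by
  rintro ⟨u, v, y, t, z, m, rfl, hl, hvy, h⟩
  exact ⟨u, v, y, t, z ++ x, m + n, by simp, hl, hvy, by simpa using h.append h'⟩

theorem append_left {n : ℕ} {x : List T} (h' : Yields R n γ x) :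
    PumpsDown R c β w → PumpsDown R c (γ ++ β) (x ++ w) := by
  rintro ⟨u, v, y, t, z, m, rfl, hl, hvy, h⟩
  exact ⟨x ++ u, v, y, t, z, n + m, by simp, hl, hvy, by simpa using h'.append h⟩

/-- If the parse trees with yield longer than `q` can be pumped down, so can the parse forests of
`β` with yield longer than `β.length * q`. -/
theorem of_length_lt {q n : ℕ} (hq : 1 ≤ q)
    (hp : ∀ k ≤ n, ∀ (A : N) (w : List T), Yields R k [.nonterminal A] w → q < w.length →
      PumpsDown R c [.nonterminal A] w)
    (h : Yields R n β w) (hw : β.length * q < w.length) : PumpsDown R c β w := by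
  induction h with
  | nil => simp at hw
  | terminal t _ ih =>
    refine append_left (Yields.map_terminal [t]) (ih hp ?_)
    simp only [List.length_cons, add_mul] at hw
    omega
  | @nonterminal n m _ u _ r hr h₁ h₂ _ ih =>
    by_cases hu : q < u.length
    · exact append_right h₂ (hp (n + 1) (by omega) _ _ (h₁.of_rule hr) hu)
    · refine append_left (h₁.of_rule hr) (ih (fun k hk => hp k (by omega)) ?_)
      simp only [List.length_cons, List.length_append, add_mul] at hw
      omega

end PumpsDown

theorem exists_pumpsDown (M : ℕ) (R : Finset (ContextFreeRule T N))
    (hR : ∀ r ∈ R, r.output.length ≤ M) :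
    ∃ p c, 1 ≤ p ∧ ∀ n (A : N) (w : List T), Yields R n [.nonterminal A] w → p < w.length →
      PumpsDown R c [.nonterminal A] w := by
  classical
  induction R using Finset.strongInduction with
  | H R ih =>
  have hsub : ∀ A : N, ∃ p c, 1 ≤ p ∧ ((∃ r ∈ R, r.input = A) → ∀ n (B : N) (w : List T),
      Yields (R.filter fun r => r.input ≠ A) n [.nonterminal B] w → p < w.length →
      PumpsDown (R.filter fun r => r.input ≠ A) c [.nonterminal B] w) := by
    intro A
    by_cases hA : ∃ r ∈ R, r.input = A
    · obtain ⟨p, c, hp, h⟩ := ih (R.filter fun r => r.input ≠ A)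
        (Finset.filter_ssubset.2 (by simpa using hA)) fun r hr => hR r (Finset.mem_filter.1 hr).1
      exact ⟨p, c, hp, fun _ => h⟩
    · exact ⟨1, 0, le_rfl, fun h => absurd h hA⟩
  choose p c hp hpump using hsub
  set P := M * ∑ r ∈ R, p r.input + 1 with hP
  set C := (∑ r ∈ R, c r.input) + M * P with hC
  refine ⟨P, C, by omega, fun n => ?_⟩
  induction n using Nat.strong_induction_on with
  | _ n ihn =>
  intro A w h hw
  cases h with
  | @nonterminal n₁ n₂ _ w w₂ r hr h h₂ =>
  cases h₂
  rw [List.append_nil] at hw ⊢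
  by_cases hlong : M * P < w.length
  · exact .of_rule hr (.of_length_lt (by omega) (fun k hk => ihn k (by omega)) h
      ((Nat.mul_le_mul_right P (hR r hr)).trans_lt hlong))
  have hpr : p r.input ≤ ∑ r ∈ R, p r.input :=
    Finset.single_le_sum (f := fun r : ContextFreeRule T N => p r.input) (by simp) hr
  have hcr : c r.input ≤ ∑ r ∈ R, c r.input :=
    Finset.single_le_sum (f := fun r : ContextFreeRule T N => c r.input) (by simp) hr
  obtain h' | ⟨u, x, z, k, rfl, hk, hx⟩ := h.avoid_or_exists_subtree r.input
  · refine .of_rule hr (.mono (Finset.filter_subset _ _) (hcr.trans (Nat.le_add_right _ _))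
      (.of_length_lt (hp r.input) (fun k _ => hpump r.input ⟨r, hr, rfl⟩ k) h' ?_))
    have := Nat.mul_le_mul (hR r hr) hpr
    omega
  · by_cases huz : 1 ≤ (u ++ z).length
    · exact ⟨[], u, x, z, [], k, by simp, by omega, huz, by simpa using hx⟩
    · have huz' : u = [] ∧ z = [] := by
        simpa using List.eq_nil_of_length_eq_zero (l := u ++ z) (by omega)
      obtain ⟨rfl, rfl⟩ := huz'
      simp only [List.nil_append, List.append_nil] at hw ⊢
      exact ihn k (by omega) _ _ hx hw

end ContextFreeGrammar

/-- The downward half of the pumping lemma for context-free languages. -/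
theorem Language.IsContextFree.exists_pump_down {T : Type*} {L : Language T}
    (hL : L.IsContextFree) :
    ∃ p : ℕ, ∀ w ∈ L, p < w.length → ∃ u v x y z, w = u ++ (v ++ x ++ y) ++ z ∧
      (v ++ x ++ y).length ≤ p ∧ 1 ≤ (v ++ y).length ∧ u ++ x ++ z ∈ L := by
  obtain ⟨g, rfl⟩ := hL
  obtain ⟨p, c, -, h⟩ := ContextFreeGrammar.exists_pumpsDown
    (∑ r ∈ g.rules, r.output.length) g.rules fun r hr =>
      Finset.single_le_sum (f := fun r : ContextFreeRule T g.NT => r.output.length)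
        (by simp) hr
  refine ⟨p + c, fun w hw hlen => ?_⟩
  obtain ⟨n, hn⟩ := ContextFreeGrammar.Derives.exists_yields
    ((ContextFreeGrammar.mem_language_iff g w).1 hw)
  obtain ⟨u, v, x, y, z, m, hw', hl, hvy, hm⟩ := h n _ _ hn (by omega)
  exact ⟨u, v, x, y, z, hw', by omega, hvy,
    (ContextFreeGrammar.mem_language_iff g _).2 hm.derives⟩

theorem List.le_of_replicate_append_eq {α : Type*} {a b : α} (hab : a ≠ b) {k n : ℕ}
    {s t t' r r' : List α} (h : s ++ t = List.replicate k a ++ r) (hs : k ≤ s.length)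
    (h' : s ++ t' = List.replicate n a ++ b :: r') : k ≤ n := by
  by_contra! hn
  have h₁ : s[n]? = some a := by
    rw [← List.getElem?_append_left (l₂ := t) (by omega), h,
      List.getElem?_append_left (by simpa using hn), List.getElem?_replicate, if_pos hn]
  have h₂ : s[n]? = some b := by
    rw [← List.getElem?_append_left (l₂ := t') (by omega), h',
      List.getElem?_append_right (by simp)]
    simp
  exact hab (Option.some_injective _ (h₁.symm.trans h₂))

theorem ML_not_isContextFree : ¬ Language.IsContextFree ML := by
  intro hML
  have hab : AB.a ≠ AB.b := by simp
  obtain ⟨p, hp⟩ := hML.exists_pump_down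
  set k := p + 1 with hk
  set w := List.replicate k AB.a ++ List.replicate (2 * k) AB.b ++ List.replicate k AB.a with hw
  have hmem : w ∈ ML := (ML_inter_eq.ge ⟨k, by omega, rfl⟩).1
  have hlen : w.length = 4 * k := by simp [hw]; omega
  obtain ⟨u, v, x, y, z, hdec, hl, hvy, hdel⟩ := hp w hmem (by omega)
  have hsub : List.Sublist (u ++ x ++ z) w := by
    rw [hdec]
    refine .append (.append (.refl _) ?_) (.refl _)
    exact (List.sublist_append_right v x).trans (List.sublist_append_left _ y)
  obtain ⟨n, hn, hpumped⟩ : ∃ n : ℕ, 1 ≤ n ∧ u ++ x ++ z =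
      List.replicate n AB.a ++ List.replicate (2 * n) AB.b ++ List.replicate n AB.a := by
    refine ML_inter_eq.le ⟨hdel, ?_⟩
    obtain ⟨l, l₃, hl, h, h₃⟩ := List.sublist_append_iff.1 hsub
    obtain ⟨l₁, l₂, rfl, h₁, h₂⟩ := List.sublist_append_iff.1 h
    obtain ⟨i, -, rfl⟩ := List.sublist_replicate_iff.1 h₁
    obtain ⟨j, -, rfl⟩ := List.sublist_replicate_iff.1 h₂
    obtain ⟨m, -, rfl⟩ := List.sublist_replicate_iff.1 h₃
    exact ⟨i, j, m, hl⟩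
  have hlen₁ := congrArg List.length hdec
  have hlen₂ := congrArg List.length hpumped
  simp only [List.length_append, List.length_replicate] at hlen₁ hlen₂ hl hvy
  have hnk : n < k := by omega
  have hb : List.replicate (2 * n) AB.b = AB.b :: List.replicate (2 * n - 1) AB.b := by
    rw [← List.replicate_succ]; congr 1; omega
  refine hnk.not_ge ?_
  by_cases hu : k ≤ u.length
  · refine List.le_of_replicate_append_eq hab (s := u) (t := (v ++ x ++ y) ++ z) (t' := x ++ z)
      (r := List.replicate (2 * k) AB.b ++ List.replicate k AB.a)
      (r' := List.replicate (2 * n - 1) AB.b ++ List.replicate n AB.a) ?_ hu ?_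
    · rw [← List.append_assoc, ← hdec, hw, List.append_assoc]
    · rw [← List.append_assoc, hpumped, hb]; simp
  · have hrev := congrArg List.reverse (hw.symm.trans hdec)
    have hrev' := congrArg List.reverse hpumped
    simp only [List.reverse_append, List.reverse_replicate] at hrev hrev'
    rw [hb, List.cons_append] at hrev'
    exact List.le_of_replicate_append_eq hab hrev.symm (by simp; omega) hrev'

/-- `M_L ∩ a^* b^* a^* = {aⁿ b^(2n) aⁿ : n ≥ 1}`, hence `M_L` is not context-free. -/
theorem stmt_13 :
    ML ∩
        {z | ∃ i j k : ℕ, z = List.replicate i AB.a ++ List.replicate j AB.b ++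
            List.replicate k AB.a} =
      {z | ∃ n : ℕ, 1 ≤ n ∧
          z = List.replicate n AB.a ++ List.replicate (2 * n) AB.b ++ List.replicate n AB.a} ∧
    ¬ Language.IsContextFree ML := by
  exact ⟨ML_inter_eq, ML_not_isContextFree⟩
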